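/- arXiv:2007.11248 — 5 statements merged into one kernel-verified Lean document; each statement's English description precedes it below -/
import Mathlib

section
/- Let a, b ∈ (1/2, 1) with a ≠ b, and set α = exp(−2πi·a), β = exp(−2πi·b) (so α, β ∉ {1, −1} and α ∉ {β, β⁻¹}). Then there exist matrices A₀, A₁, A₄, A_∞ ∈ GL₄(ℂ) such that: (i) A₀·A₁·A₄·A_∞ = I; (ii) A₀ and A₄ are each conjugate in GL₄(ℂ) to the block-diagonal matrix diag(J₂(1), 1, 1); (iii) A₁ is conjugate to the diagonal matrix diag(α, α⁻¹, 1, 1); (iv) A_∞ is conjugate to the diagonal matrix diag(β, β, β⁻¹, β⁻¹); (v) the tuple (A₀, A₁, A₄, A_∞) is irreducible; (vi) there exists an invertible matrix S ∈ GL₄(ℂ) with Sᵀ = −S and AᵀSA = S for each A ∈ {A₀, A₁, A₄, A_∞} (i.e., the tuple preserves a nondegenerate alternating bilinear form, so its monodromy group is symplectic). -/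
/-!
Statement 3: existence of the monodromy tuple of the rigid local system 𝒫₁₃
(case α ≠ −1, β ≠ −1), with symplectic monodromy group.
-/

open Matrix

/-- Two square matrices are conjugate (by an invertible matrix). -/
def MatConj {n : ℕ} (A B : Matrix (Fin n) (Fin n) ℂ) : Prop :=
  ∃ C : Matrix (Fin n) (Fin n) ℂ, IsUnit C ∧ C * A * C⁻¹ = B

/-- A set of matrices acts irreducibly on ℂⁿ: the only common invariant
subspaces are `⊥` and `⊤`. -/
def MatIrred {n : ℕ} (s : Set (Matrix (Fin n) (Fin n) ℂ)) : Prop :=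
  ∀ W : Submodule ℂ (Fin n → ℂ), (∀ A ∈ s, ∀ v ∈ W, A.mulVec v ∈ W) → W = ⊥ ∨ W = ⊤

theorem Matrix.mul_eq_mul_diagonal_of_sq_eq {n : ℕ} {A X D E : Matrix (Fin n) (Fin n) ℂ} {t : ℂ}
    (hA : A * A = t • A - 1) (hDE : D + E = t • 1) (hED : E * D = 1) :
    A * (A * X - X * E) = (A * X - X * E) * D := by
  have hE : E = t • 1 - D := by rw [← hDE]; abel
  rw [sub_mul, mul_sub, ← mul_assoc, hA, mul_assoc X E D, hED, hE]
  simp only [sub_mul, mul_sub, smul_mul_assoc, mul_smul_comm, one_mul, mul_one, mul_assoc]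
  abel

theorem MatConj.of_mul_eq_mul {n : ℕ} {A B P : Matrix (Fin n) (Fin n) ℂ} (hP : P.det ≠ 0)
    (h : A * P = P * B) : MatConj A B := by
  have hu : IsUnit P.det := hP.isUnit
  refine ⟨P⁻¹, by simpa [Matrix.isUnit_iff_isUnit_det] using hP, ?_⟩
  rw [Matrix.nonsing_inv_nonsing_inv P hu, mul_assoc, h, ← mul_assoc, Matrix.nonsing_inv_mul P hu,
    one_mul]

/-- The alternating form preserved by the tuple. -/
def symplecticForm (r : ℂ) : Matrix (Fin 4) (Fin 4) ℂ :=
  !![0, r, 0, 0; -r, 0, 0, 0; 0, 0, 0, 1; 0, 0, -1, 0]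

/-- The map `x ↦ x + c * ω(u, x) • u`, where `ω` is the form given by `symplecticForm r`. -/
def symplecticTransvection (r c : ℂ) (u : Fin 4 → ℂ) : Matrix (Fin 4) (Fin 4) ℂ :=
  1 + c • vecMulVec u (u ᵥ* symplecticForm r)

theorem vecMul_symplecticForm (r : ℂ) (u : Fin 4 → ℂ) :
    u ᵥ* symplecticForm r = ![-r * u 1, r * u 0, -u 3, u 2] := by
  ext i
  fin_cases i <;> simp [symplecticForm, vecMul, dotProduct, Fin.sum_univ_four, mul_comm]

theorem symplecticTransvection_eq (r c x y z w : ℂ) :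
    symplecticTransvection r c ![x, y, z, w] =
      !![1 - c * x * r * y, c * x * r * x, -c * x * w, c * x * z;
        -c * y * r * y, 1 + c * y * r * x, -c * y * w, c * y * z;
        -c * z * r * y, c * z * r * x, 1 - c * z * w, c * z * z;
        -c * w * r * y, c * w * r * x, -c * w * w, 1 + c * w * z] := by
  ext i j
  fin_cases i <;> fin_cases j <;>
    simp [symplecticTransvection, vecMul_symplecticForm, vecMulVec] <;> ring

theorem symplecticTransvection_mul_neg (r c : ℂ) (u : Fin 4 → ℂ) :
    symplecticTransvection r c u * symplecticTransvection r (-c) u = 1 := by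
  have h : vecMulVec u (u ᵥ* symplecticForm r) * vecMulVec u (u ᵥ* symplecticForm r) = 0 := by
    rw [vecMulVec_mul_vecMulVec]
    have : (u ᵥ* symplecticForm r) ⬝ᵥ u = 0 := by
      rw [vecMul_symplecticForm]
      simp [dotProduct, Fin.sum_univ_four]
      ring
    simp [this]
  simp [symplecticTransvection, add_mul, mul_add, h]

theorem symplecticTransvection_preserves (r c : ℂ) (u : Fin 4 → ℂ) :
    (symplecticTransvection r c u)ᵀ * symplecticForm r * symplecticTransvection r c u =
      symplecticForm r := by
  obtain ⟨x, y, z, w, rfl⟩ : ∃ x y z w, u = ![x, y, z, w] :=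
    ⟨u 0, u 1, u 2, u 3, by ext i; fin_cases i <;> rfl⟩
  rw [symplecticTransvection_eq, symplecticForm]
  ext i j
  fin_cases i <;> fin_cases j <;>
    simp [Matrix.mul_apply, Fin.sum_univ_four] <;> ring

theorem preserves_mul {n : ℕ} {A B S : Matrix (Fin n) (Fin n) ℂ} (hA : Aᵀ * S * A = S)
    (hB : Bᵀ * S * B = S) : (A * B)ᵀ * S * (A * B) = S := by
  calc (A * B)ᵀ * S * (A * B) = Bᵀ * (Aᵀ * S * A) * B := by
        rw [transpose_mul]; simp only [mul_assoc]
    _ = S := by rw [hA, hB]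

theorem matConj_symplecticTransvection_of_third {r c x y z w : ℂ} (hc : c ≠ 0) (hz : z ≠ 0) :
    MatConj (symplecticTransvection r c ![x, y, z, w])
      !![1, 1, 0, 0; 0, 1, 0, 0; 0, 0, 1, 0; 0, 0, 0, 1] := by
  refine .of_mul_eq_mul (P := !![c * z * x, 0, z, 0; c * z * y, 0, 0, z; c * z * z, 0, 0, 0;
    c * z * w, 1, r * y, -(r * x)]) ?_ ?_
  · simp [det_succ_row_zero, Fin.sum_univ_succ, Fin.succAbove, hc, hz]
  · rw [symplecticTransvection_eq]
    ext i j
    fin_cases i <;> fin_cases j <;> simp <;> ring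

theorem matConj_symplecticTransvection_of_fourth {r c x y z w : ℂ} (hc : c ≠ 0) (hw : w ≠ 0) :
    MatConj (symplecticTransvection r c ![x, y, z, w])
      !![1, 1, 0, 0; 0, 1, 0, 0; 0, 0, 1, 0; 0, 0, 0, 1] := by
  refine .of_mul_eq_mul (P := !![-(c * w * x), 0, w, 0; -(c * w * y), 0, 0, w;
    -(c * w * z), 1, -(r * y), r * x; -(c * w * w), 0, 0, 0]) ?_ ?_
  · simp [det_succ_row_zero, Fin.sum_univ_succ, Fin.succAbove, hc, hw]
  · rw [symplecticTransvection_eq]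
    ext i j
    fin_cases i <;> fin_cases j <;> simp <;> ring

theorem mem_of_symplecticTransvection_mulVec_mem {W : Submodule ℂ (Fin 4 → ℂ)} {r c : ℂ}
    {u v : Fin 4 → ℂ} (hc : c ≠ 0) (hW : ∀ v ∈ W, symplecticTransvection r c u *ᵥ v ∈ W)
    (hv : v ∈ W) (h : (u ᵥ* symplecticForm r) ⬝ᵥ v ≠ 0) : u ∈ W := by
  have h1 := W.sub_mem (hW v hv) hv
  have h2 : symplecticTransvection r c u *ᵥ v - v =
      (c * ((u ᵥ* symplecticForm r) ⬝ᵥ v)) • u := by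
    rw [symplecticTransvection, add_mulVec, one_mulVec, smul_mulVec, vecMulVec_mulVec]
    ext i
    simp
    ring
  rw [h2] at h1
  exact (W.smul_mem_iff (mul_ne_zero hc h)).1 h1

theorem mem_components_of_diagonal {W : Submodule ℂ (Fin 4 → ℂ)} {α γ : ℂ} (h1 : α ≠ 1)
    (h2 : γ ≠ 1) (h3 : α ≠ γ)
    (hW : ∀ v ∈ W, !![α, 0, 0, 0; 0, γ, 0, 0; 0, 0, 1, 0; 0, 0, 0, 1] *ᵥ v ∈ W)
    {v : Fin 4 → ℂ} (hv : v ∈ W) :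
    ![v 0, 0, 0, 0] ∈ W ∧ ![0, v 1, 0, 0] ∈ W ∧ ![0, 0, v 2, v 3] ∈ W := by
  have key : ∀ p : ℂ, ∀ v ∈ W,
      ![(α - p) * v 0, (γ - p) * v 1, (1 - p) * v 2, (1 - p) * v 3] ∈ W := by
    intro p v hv
    convert W.sub_mem (hW v hv) (W.smul_mem p hv) using 1
    ext i
    fin_cases i <;> simp [dotProduct, Fin.sum_univ_four] <;> ring
  refine ⟨?_, ?_, ?_⟩
  · rw [← W.smul_mem_iff (mul_ne_zero (sub_ne_zero.2 h3) (sub_ne_zero.2 h1))]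
    convert key γ _ (key 1 v hv) using 1
    ext i
    fin_cases i <;> simp [mul_assoc]
  · rw [← W.smul_mem_iff (mul_ne_zero (sub_ne_zero.2 h3.symm) (sub_ne_zero.2 h2))]
    convert key α _ (key 1 v hv) using 1
    ext i
    fin_cases i <;> simp [mul_assoc]
  · rw [← W.smul_mem_iff (mul_ne_zero (sub_ne_zero.2 h1.symm) (sub_ne_zero.2 h2.symm))]
    convert key α _ (key γ v hv) using 1
    ext i
    fin_cases i <;> simp [mul_assoc]

/-- The tuple formed by two symplectic transvections and a diagonal matrix with eigenvalues
`α`, `γ`, `1`, `1` is irreducible as soon as its vectors are in general position. -/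
theorem eq_bot_or_eq_top_of_invariant {W : Submodule ℂ (Fin 4 → ℂ)} {α γ r c x y τ : ℂ}
    (h1 : α ≠ 1) (h2 : γ ≠ 1) (h3 : α ≠ γ) (hr : r ≠ 0) (hc : c ≠ 0) (hx : x ≠ 0) (hy : y ≠ 0)
    (hτ : τ ≠ 0)
    (hD : ∀ v ∈ W, !![α, 0, 0, 0; 0, γ, 0, 0; 0, 0, 1, 0; 0, 0, 0, 1] *ᵥ v ∈ W)
    (hu : ∀ v ∈ W, symplecticTransvection r c ![x, y, 1, 0] *ᵥ v ∈ W)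
    (hw : ∀ v ∈ W, symplecticTransvection r 1 ![1, 1, 0, τ] *ᵥ v ∈ W) : W = ⊥ ∨ W = ⊤ := by
  have comp {v : Fin 4 → ℂ} (hv : v ∈ W) := mem_components_of_diagonal h1 h2 h3 hD hv
  have htop (hu' : ![x, y, 1, 0] ∈ W) : W = ⊤ := by
    obtain ⟨e0, e1, e2⟩ := comp hu'
    simp only [Fin.isValue, cons_val] at e0 e1 e2
    have hw' : ![1, 1, 0, τ] ∈ W := by
      refine mem_of_symplecticTransvection_mulVec_mem one_ne_zero hw e2 ?_
      simp [vecMul_symplecticForm, dotProduct, Fin.sum_univ_four, hτ]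
    have e3 := (comp hw').2.2
    simp only [Fin.isValue, cons_val] at e3
    rw [eq_top_iff]
    intro v _
    convert W.add_mem (W.add_mem (W.smul_mem (v 0 / x) e0) (W.smul_mem (v 1 / y) e1))
      (W.add_mem (W.smul_mem (v 2) e2) (W.smul_mem (v 3 / τ) e3)) using 1
    ext i
    fin_cases i <;> simp [hx, hy, hτ]
  by_cases hW : W = ⊥
  · exact .inl hW
  refine .inr (htop ?_)
  obtain ⟨v, hv, hv0⟩ := W.ne_bot_iff.1 hW
  obtain ⟨e0, e1, e2⟩ := comp hv
  have hmem {v : Fin 4 → ℂ} (hv : v ∈ W) :=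
    mem_of_symplecticTransvection_mulVec_mem (v := v) hc hu hv
  by_cases hv0' : v 0 = 0
  swap
  · exact hmem e0 (by simp [vecMul_symplecticForm, dotProduct, Fin.sum_univ_four, hr, hy, hv0'])
  by_cases hv1 : v 1 = 0
  swap
  · exact hmem e1 (by simp [vecMul_symplecticForm, dotProduct, Fin.sum_univ_four, hr, hx, hv1])
  by_cases hv3 : v 3 = 0
  swap
  · exact hmem e2 (by simp [vecMul_symplecticForm, dotProduct, Fin.sum_univ_four, hv3])
  have hv2 : v 2 ≠ 0 := fun hv2 => hv0 (by ext i; fin_cases i <;> assumption)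
  have hw' : ![1, 1, 0, τ] ∈ W := by
    refine mem_of_symplecticTransvection_mulVec_mem one_ne_zero hw e2 ?_
    simp [vecMul_symplecticForm, dotProduct, Fin.sum_univ_four, hτ, hv2]
  have e0' := (comp hw').1
  exact hmem e0' (by simp [vecMul_symplecticForm, dotProduct, Fin.sum_univ_four, hr, hy])

set_option maxHeartbeats 4000000 in
theorem transvection_mul_diagonal_add_inv (α r : ℂ) (h0 : α ≠ 0) (h1 : α ≠ 1) (t : ℂ)
    (ht : t = α + α⁻¹ - r * (α - α⁻¹)) :
    symplecticTransvection r (-1) ![1, 1, 0, t - 2] *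
        !![α⁻¹, 0, 0, 0; 0, α, 0, 0; 0, 0, 1, 0; 0, 0, 0, 1] *
        symplecticTransvection r (α / (α - 1) ^ 2) ![α - 1, α⁻¹ - 1, 1, 0] +
      symplecticTransvection r (-(α / (α - 1) ^ 2)) ![α - 1, α⁻¹ - 1, 1, 0] *
        !![α, 0, 0, 0; 0, α⁻¹, 0, 0; 0, 0, 1, 0; 0, 0, 0, 1] *
        symplecticTransvection r 1 ![1, 1, 0, t - 2] = t • 1 := by
  have h2 : α - 1 ≠ 0 := sub_ne_zero.2 h1
  subst ht
  simp only [symplecticTransvection_eq]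
  ext i j
  fin_cases i <;> fin_cases j <;> simp <;> field_simp <;> ring

theorem matConj_diagonal_of_transvection_mul (α β r : ℂ) (hα : α ≠ 0) (hα1 : α ≠ 1)
    (hαα : α ≠ α⁻¹) (hβ : β ≠ 0) (hβ1 : β ≠ 1) (hββ : β ≠ β⁻¹)
    (hr : β + β⁻¹ = α + α⁻¹ - r * (α - α⁻¹)) {A : Matrix (Fin 4) (Fin 4) ℂ}
    (hA : A = symplecticTransvection r (-1) ![1, 1, 0, β + β⁻¹ - 2] *
      !![α⁻¹, 0, 0, 0; 0, α, 0, 0; 0, 0, 1, 0; 0, 0, 0, 1] *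
      symplecticTransvection r (α / (α - 1) ^ 2) ![α - 1, α⁻¹ - 1, 1, 0])
    (hsq : A * A = (β + β⁻¹) • A - 1) :
    MatConj A !![β, 0, 0, 0; 0, β, 0, 0; 0, 0, β⁻¹, 0; 0, 0, 0, β⁻¹] := by
  have hα2 : α - 1 ≠ 0 := sub_ne_zero.2 hα1
  have hτ : β + β⁻¹ - 2 ≠ 0 := by
    have : β + β⁻¹ - 2 = (β - 1) ^ 2 / β := by field_simp; ring
    rw [this]
    exact div_ne_zero (pow_ne_zero _ (sub_ne_zero.2 hβ1)) hβ
  have hσ : α + α⁻¹ - 2 ≠ 0 := by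
    have : α + α⁻¹ - 2 = (α - 1) ^ 2 / α := by field_simp; ring
    rw [this]
    exact div_ne_zero (pow_ne_zero _ hα2) hα
  generalize ht : β + β⁻¹ = t at *
  set X : Matrix (Fin 4) (Fin 4) ℂ :=
    !![0, α - 1, 0, α - 1; 0, α⁻¹ - 1, 0, α⁻¹ - 1; 1, 1, 1, 1; 0, 0, 0, 0] with hX
  have hAX : A * X = !![t - 2, α - 1, t - 2, α - 1; t - 2, α⁻¹ - 1, t - 2, α⁻¹ - 1; 1, 1, 1, 1;
      (t - 2) ^ 2, (α + α⁻¹ - 2) * (t - 2), (t - 2) ^ 2, (α + α⁻¹ - 2) * (t - 2)] := by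
    rw [hA, hX, hr]
    simp only [symplecticTransvection_eq]
    ext i j
    fin_cases i <;> fin_cases j <;> simp <;> field_simp <;> ring
  refine .of_mul_eq_mul ?_ (mul_eq_mul_diagonal_of_sq_eq (X := X)
    (E := !![β⁻¹, 0, 0, 0; 0, β⁻¹, 0, 0; 0, 0, β, 0; 0, 0, 0, β]) hsq ?_ ?_)
  · have hdet : (A * X - X * !![β⁻¹, 0, 0, 0; 0, β⁻¹, 0, 0; 0, 0, β, 0; 0, 0, 0, β]).det =
        (β - β⁻¹) ^ 2 * (t - 2) ^ 2 * (α + α⁻¹ - 2) * (α - α⁻¹) := by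
      rw [hAX, hX]
      simp [det_succ_row_zero, Fin.sum_univ_succ, Fin.succAbove]
      ring
    rw [hdet]
    have := sub_ne_zero.2 hαα
    have := sub_ne_zero.2 hββ
    positivity
  · rw [← ht]
    ext i j
    fin_cases i <;> fin_cases j <;> simp [add_comm]
  · ext i j
    fin_cases i <;> fin_cases j <;> simp [hβ]

theorem exists_int_of_exp_eq_one {x : ℝ} (h : Complex.exp (-2 * Real.pi * Complex.I * x) = 1) :
    ∃ n : ℤ, x = n := by
  obtain ⟨n, hn⟩ := Complex.exp_eq_one_iff.1 h
  refine ⟨-n, ?_⟩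
  have h2 : (2 * Real.pi * Complex.I : ℂ) ≠ 0 := Complex.two_pi_I_ne_zero
  have h3 : (x : ℂ) = ((-n : ℤ) : ℂ) :=
    mul_left_cancel₀ h2 (by push_cast; linear_combination -hn)
  exact_mod_cast h3

theorem stmt_3 (a b : ℝ) (ha : a ∈ Set.Ioo (1 / 2 : ℝ) 1) (hb : b ∈ Set.Ioo (1 / 2 : ℝ) 1)
    (hab : a ≠ b) (α β : ℂ)
    (hα : α = Complex.exp (-2 * Real.pi * Complex.I * a))
    (hβ : β = Complex.exp (-2 * Real.pi * Complex.I * b)) :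
    ∃ A0 A1 A4 Ainf : Matrix (Fin 4) (Fin 4) ℂ,
      IsUnit A0 ∧ IsUnit A1 ∧ IsUnit A4 ∧ IsUnit Ainf ∧
      A0 * A1 * A4 * Ainf = 1 ∧
      MatConj A0 !![1, 1, 0, 0; 0, 1, 0, 0; 0, 0, 1, 0; 0, 0, 0, 1] ∧
      MatConj A4 !![1, 1, 0, 0; 0, 1, 0, 0; 0, 0, 1, 0; 0, 0, 0, 1] ∧
      MatConj A1 !![α, 0, 0, 0; 0, α⁻¹, 0, 0; 0, 0, 1, 0; 0, 0, 0, 1] ∧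
      MatConj Ainf !![β, 0, 0, 0; 0, β, 0, 0; 0, 0, β⁻¹, 0; 0, 0, 0, β⁻¹] ∧
      MatIrred {A0, A1, A4, Ainf} ∧
      ∃ S : Matrix (Fin 4) (Fin 4) ℂ, IsUnit S ∧ Sᵀ = -S ∧
        ∀ A ∈ ({A0, A1, A4, Ainf} : Set (Matrix (Fin 4) (Fin 4) ℂ)), Aᵀ * S * A = S := by
  obtain ⟨ha1, ha2⟩ := ha
  obtain ⟨hb1, hb2⟩ := hb
  have hα0 : α ≠ 0 := hα ▸ Complex.exp_ne_zero _
  have hβ0 : β ≠ 0 := hβ ▸ Complex.exp_ne_zero _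
  have ne_one {x : ℝ} (n : ℤ) (h1 : (n : ℝ) < x) (h2 : x < n + 1) :
      Complex.exp (-2 * Real.pi * Complex.I * x) ≠ 1 := by
    intro h
    obtain ⟨m, rfl⟩ := exists_int_of_exp_eq_one h
    norm_cast at h1 h2
    omega
  have hα1 : α ≠ 1 := hα ▸ ne_one 0 (by norm_num; linarith) (by norm_num; linarith)
  have hβ1 : β ≠ 1 := hβ ▸ ne_one 0 (by norm_num; linarith) (by norm_num; linarith)
  have mul_ne_one {x y : ℝ} (hx1 : 1 / 2 < x) (hx2 : x < 1) (hy1 : 1 / 2 < y) (hy2 : y < 1) :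
      Complex.exp (-2 * Real.pi * Complex.I * x) * Complex.exp (-2 * Real.pi * Complex.I * y) ≠
        1 := by
    rw [← Complex.exp_add, ← mul_add, ← Complex.ofReal_add]
    exact ne_one 1 (by norm_num; linarith) (by norm_num; linarith)
  have hαα : α ≠ α⁻¹ := fun h => mul_ne_one ha1 ha2 ha1 ha2 (by
    rw [← hα]; nth_rewrite 2 [h]; exact mul_inv_cancel₀ hα0)
  have hββ : β ≠ β⁻¹ := fun h => mul_ne_one hb1 hb2 hb1 hb2 (by
    rw [← hβ]; nth_rewrite 2 [h]; exact mul_inv_cancel₀ hβ0)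
  have hαβ1 : α * β ≠ 1 := by rw [hα, hβ]; exact mul_ne_one ha1 ha2 hb1 hb2
  have hαβ : α ≠ β := by
    intro h
    have h1 : Complex.exp (-2 * Real.pi * Complex.I * (a - b : ℝ)) = 1 := by
      rw [Complex.ofReal_sub, mul_sub, Complex.exp_sub, ← hα, ← hβ, h, div_self hβ0]
    obtain ⟨n, hn⟩ := exists_int_of_exp_eq_one h1
    have h2 : (-1 : ℝ) < n := by linarith
    have h3 : (n : ℝ) < 1 := by linarith
    norm_cast at h2 h3
    obtain rfl : n = 0 := by omega
    exact hab (by simpa [sub_eq_zero] using hn)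
  have hα2 : α - 1 ≠ 0 := sub_ne_zero.2 hα1
  have hα3 := sub_ne_zero.2 hαα
  have hα4 : α⁻¹ ≠ 1 := by simpa using hα1
  obtain ⟨r, hr, hr0⟩ : ∃ r : ℂ, β + β⁻¹ = α + α⁻¹ - r * (α - α⁻¹) ∧ r ≠ 0 := by
    refine ⟨(α + α⁻¹ - (β + β⁻¹)) / (α - α⁻¹), ?_, div_ne_zero ?_ hα3⟩
    · rw [div_mul_cancel₀ _ hα3]; ring
    · have : α + α⁻¹ - (β + β⁻¹) = (α - β) * (α * β - 1) / (α * β) := by field_simp; ring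
      rw [this]
      exact div_ne_zero (mul_ne_zero (sub_ne_zero.2 hαβ) (sub_ne_zero.2 hαβ1))
        (mul_ne_zero hα0 hβ0)
  have hτ : β + β⁻¹ - 2 ≠ 0 := by
    have : β + β⁻¹ - 2 = (β - 1) ^ 2 / β := by field_simp; ring
    rw [this]
    exact div_ne_zero (pow_ne_zero _ (sub_ne_zero.2 hβ1)) hβ0
  have hc : α / (α - 1) ^ 2 ≠ 0 := div_ne_zero hα0 (pow_ne_zero _ hα2)
  have hsum := transvection_mul_diagonal_add_inv α r hα0 hα1 _ hr
  have h0 := symplecticTransvection_mul_neg r (-(α / (α - 1) ^ 2)) ![α - 1, α⁻¹ - 1, 1, 0]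
  have h4 := symplecticTransvection_mul_neg r 1 ![1, 1, 0, β + β⁻¹ - 2]
  rw [neg_neg] at h0
  have p0 := symplecticTransvection_preserves r (-(α / (α - 1) ^ 2)) ![α - 1, α⁻¹ - 1, 1, 0]
  have p0' := symplecticTransvection_preserves r (α / (α - 1) ^ 2) ![α - 1, α⁻¹ - 1, 1, 0]
  have p4 := symplecticTransvection_preserves r 1 ![1, 1, 0, β + β⁻¹ - 2]
  have p4' := symplecticTransvection_preserves r (-1) ![1, 1, 0, β + β⁻¹ - 2]
  have c0 : MatConj (symplecticTransvection r (-(α / (α - 1) ^ 2)) ![α - 1, α⁻¹ - 1, 1, 0]) _ :=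
    matConj_symplecticTransvection_of_third (neg_ne_zero.2 hc) one_ne_zero
  have c4 : MatConj (symplecticTransvection r 1 ![1, 1, 0, β + β⁻¹ - 2]) _ :=
    matConj_symplecticTransvection_of_fourth one_ne_zero hτ
  have irr (W : Submodule ℂ (Fin 4 → ℂ)) :=
    eq_bot_or_eq_top_of_invariant (W := W) hα1 hα4 hαα hr0 (neg_ne_zero.2 hc) hα2
      (sub_ne_zero.2 hα4) hτ
  have cinf := matConj_diagonal_of_transvection_mul α β r hα0 hα1 hαα hβ0 hβ1 hββ hr rfl
  generalize symplecticTransvection r (-(α / (α - 1) ^ 2)) ![α - 1, α⁻¹ - 1, 1, 0] = A0 at *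
  generalize symplecticTransvection r (α / (α - 1) ^ 2) ![α - 1, α⁻¹ - 1, 1, 0] = B0 at *
  generalize symplecticTransvection r 1 ![1, 1, 0, β + β⁻¹ - 2] = A4 at *
  generalize symplecticTransvection r (-1) ![1, 1, 0, β + β⁻¹ - 2] = B4 at *
  have h1 : (!![α, 0, 0, 0; 0, α⁻¹, 0, 0; 0, 0, 1, 0; 0, 0, 0, 1] : Matrix (Fin 4) (Fin 4) ℂ) *
      !![α⁻¹, 0, 0, 0; 0, α, 0, 0; 0, 0, 1, 0; 0, 0, 0, 1] = 1 := by
    ext i j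
    fin_cases i <;> fin_cases j <;> simp [hα0]
  have p1 {x y : ℂ} (hxy : x * y = 1) :
      (!![x, 0, 0, 0; 0, y, 0, 0; 0, 0, 1, 0; 0, 0, 0, 1])ᵀ * symplecticForm r *
        !![x, 0, 0, 0; 0, y, 0, 0; 0, 0, 1, 0; 0, 0, 0, 1] = symplecticForm r := by
    ext i j
    fin_cases i <;> fin_cases j <;> simp [symplecticForm, Matrix.mul_apply, Fin.sum_univ_four] <;>
      linear_combination r * hxy
  have c1 : MatConj !![α, 0, 0, 0; 0, α⁻¹, 0, 0; 0, 0, 1, 0; 0, 0, 0, 1]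
      !![α, 0, 0, 0; 0, α⁻¹, 0, 0; 0, 0, 1, 0; 0, 0, 0, 1] := ⟨1, isUnit_one, by simp⟩
  have p1a := p1 (mul_inv_cancel₀ hα0)
  have p1b := p1 (inv_mul_cancel₀ hα0)
  clear p1
  generalize !![α, 0, 0, 0; 0, α⁻¹, 0, 0; 0, 0, 1, 0; 0, 0, 0, 1] = A1 at irr hsum h1 c1 p1a ⊢
  generalize !![α⁻¹, 0, 0, 0; 0, α, 0, 0; 0, 0, 1, 0; 0, 0, 0, 1] = B1 at *
  have hprod : A0 * A1 * A4 * (B4 * B1 * B0) = 1 := by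
    calc A0 * A1 * A4 * (B4 * B1 * B0) = A0 * (A1 * (A4 * B4) * B1) * B0 := by
          simp only [mul_assoc]
      _ = 1 := by rw [h4, mul_one, h1, mul_one, h0]
  have hsq : B4 * B1 * B0 * (B4 * B1 * B0) = (β + β⁻¹) • (B4 * B1 * B0) - 1 := by
    rw [← hprod, eq_sub_iff_add_eq, ← add_mul, hsum, smul_mul_assoc, one_mul]
  have hunit := IsUnit.of_mul_eq_one_right _ hprod
  refine ⟨A0, A1, A4, B4 * B1 * B0, .of_mul_eq_one _ h0, .of_mul_eq_one _ h1, .of_mul_eq_one _ h4,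
    hunit, hprod, c0, c4, c1, cinf hsq, ?_, symplecticForm r, ?_, ?_, ?_⟩
  · exact fun W hW => irr W (hW A1 (by simp)) (hW A0 (by simp)) (hW A4 (by simp))
  · rw [Matrix.isUnit_iff_isUnit_det]
    simp [symplecticForm, det_succ_row_zero, Fin.sum_univ_succ, Fin.succAbove, hr0]
  · ext i j
    fin_cases i <;> fin_cases j <;> simp [symplecticForm]
  · rintro A (rfl | rfl | rfl | rfl)
    exacts [p0, p1a, p4, preserves_mul (preserves_mul p4' p1b) p0']
end

section
/- Let a, b ∈ (1/2, 1) with a ≠ b, and set α = exp(−2πi·a), β = exp(−2πi·b). Suppose (A₀, A₁, A₄, A_∞) and (B₀, B₁, B₄, B_∞) are two irreducible tuples in GL₄(ℂ) such that in each tuple the product of the four matrices (in the given order) is the identity, the matrices in position 0 and position 4 are conjugate in GL₄(ℂ) to diag(J₂(1), 1, 1), the matrix in position 1 is conjugate to diag(α, α⁻¹, 1, 1), and the matrix in position ∞ is conjugate to diag(β, β, β⁻¹, β⁻¹). Then the two tuples are simultaneously conjugate: there exists C ∈ GL₄(ℂ) with C·A_s·C⁻¹ = B_s for every s ∈ {0,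 1, 4, ∞}. (This is the linear rigidity of the monodromy tuple of the rigid local system 𝒫₁₃.) -/
/-!
Statement 6: linear rigidity of the monodromy tuple of the rigid local
system 𝒫₁₃ (case α ≠ −1, β ≠ −1): any two irreducible tuples with the given
local conjugacy classes and product one are simultaneously conjugate.
-/

open Matrix

/-- Scott's lemma for four operators with product one and with neither invariant vectors nor
invariant functionals. -/
theorem two_mul_finrank_le_of_mul_eq_one {K V : Type*} [Field K] [AddCommGroup V] [Module K V]
    [FiniteDimensional K V] (T₁ T₂ T₃ T₄ : Module.End K V) (hT : T₁ * T₂ * T₃ * T₄ = 1)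
    (hinv : ∀ v, T₁ v = v → T₂ v = v → T₃ v = v → T₄ v = v → v = 0)
    (hdual : ∀ f : V →ₗ[K] K, (∀ v, f (T₁ v) = f v) → (∀ v, f (T₂ v) = f v) →
      (∀ v, f (T₃ v) = f v) → (∀ v, f (T₄ v) = f v) → f = 0) :
    2 * Module.finrank K V ≤
      Module.finrank K (LinearMap.range (T₁ - 1)) + Module.finrank K (LinearMap.range (T₂ - 1)) +
        Module.finrank K (LinearMap.range (T₃ - 1)) +
        Module.finrank K (LinearMap.range (T₄ - 1)) := by
  let R₁ := LinearMap.range (T₁ - 1)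
  let R₂ := LinearMap.range (T₂ - 1)
  let R₃ := LinearMap.range (T₃ - 1)
  let R₄ := LinearMap.range (T₄ - 1)
  let δ : (((R₁ × R₂) × R₃) × R₄) →ₗ[K] V :=
    ((R₁.subtype.coprod R₂.subtype).coprod R₃.subtype).coprod R₄.subtype
  let γ : V →ₗ[K] (((R₁ × R₂) × R₃) × R₄) :=
    ((((T₁ - 1).rangeRestrict ∘ₗ (T₂ * T₃ * T₄)).prod
      ((T₂ - 1).rangeRestrict ∘ₗ (T₃ * T₄))).prod
      ((T₃ - 1).rangeRestrict ∘ₗ T₄)).prod (T₄ - 1).rangeRestrict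
  have hγ : LinearMap.ker γ = ⊥ := by
    refine LinearMap.ker_eq_bot'.2 fun v hv => ?_
    have h₄ : T₄ v = v := by
      have := congrArg (fun w => (w.2 : V)) hv
      simpa [γ, sub_eq_zero] using this
    have h₃ : T₃ v = v := by
      have := congrArg (fun w => (w.1.2 : V)) hv
      simpa [γ, sub_eq_zero, h₄] using this
    have h₂ : T₂ v = v := by
      have := congrArg (fun w => (w.1.1.2 : V)) hv
      simpa [γ, sub_eq_zero, h₃, h₄] using this
    have h₁ : T₁ v = v := by
      have := congrArg (fun w => (w.1.1.1 : V)) hv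
      simpa [γ, sub_eq_zero, h₂, h₃, h₄] using this
    exact hinv v h₁ h₂ h₃ h₄
  have hδ : LinearMap.range δ = ⊤ := by
    by_contra hne
    obtain ⟨f, hf, hle⟩ := Submodule.exists_le_ker_of_lt_top _ (lt_top_iff_ne_top.2 hne)
    have key (w) : f (δ w) = 0 := hle ⟨w, rfl⟩
    refine hf (hdual f (fun v => ?_) (fun v => ?_) (fun v => ?_) (fun v => ?_))
    · simpa [δ, sub_eq_zero] using key (((⟨(T₁ - 1) v, v, rfl⟩, 0), 0), 0)
    · simpa [δ, sub_eq_zero] using key (((0, ⟨(T₂ - 1) v, v, rfl⟩), 0), 0)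
    · simpa [δ, sub_eq_zero] using key ((0, ⟨(T₃ - 1) v, v, rfl⟩), 0)
    · simpa [δ, sub_eq_zero] using key (0, ⟨(T₄ - 1) v, v, rfl⟩)
  have hle : LinearMap.range γ ≤ LinearMap.ker δ := by
    rintro _ ⟨v, rfl⟩
    have h : T₁ (T₂ (T₃ (T₄ v))) = v := congrArg (fun T : Module.End K V => T v) hT
    simp [γ, δ, h]
  have h₁ := LinearMap.finrank_range_add_finrank_ker γ
  have h₂ := LinearMap.finrank_range_add_finrank_ker δ
  have h₃ := Submodule.finrank_mono hle
  rw [hγ, finrank_bot] at h₁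
  rw [hδ, finrank_top] at h₂
  simp only [Module.finrank_prod] at h₂
  change _ ≤ Module.finrank K R₁ + Module.finrank K R₂ + Module.finrank K R₃ + Module.finrank K R₄
  omega

/-- The operator `X ↦ B * X * A⁻¹`, whose fixed points are the `X` with `B * X = X * A`. -/
noncomputable def twistedConj {n : ℕ} (A B : Matrix (Fin n) (Fin n) ℂ) :
    Module.End ℂ (Matrix (Fin n) (Fin n) ℂ) :=
  LinearMap.mulLeft ℂ B * LinearMap.mulRight ℂ A⁻¹

theorem twistedConj_apply {n : ℕ} (A B X : Matrix (Fin n) (Fin n) ℂ) :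
    twistedConj A B X = B * X * A⁻¹ := by
  simp [twistedConj, mul_assoc]

theorem twistedConj_eq_self {n : ℕ} {A B X : Matrix (Fin n) (Fin n) ℂ} (hA : IsUnit A)
    (h : twistedConj A B X = X) : X * A = B * X := by
  rw [twistedConj_apply] at h
  conv_lhs => rw [← h]
  exact Matrix.nonsing_inv_mul_cancel_right A _ ((Matrix.isUnit_iff_isUnit_det A).1 hA)

theorem MatConj.exists_eq {n : ℕ} {A D : Matrix (Fin n) (Fin n) ℂ} (h : MatConj A D) :
    ∃ C : Matrix (Fin n) (Fin n) ℂ, IsUnit C ∧ A = C⁻¹ * D * C := by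
  obtain ⟨C, hC, rfl⟩ := h
  have hd := (Matrix.isUnit_iff_isUnit_det C).1 hC
  exact ⟨C, hC, by simp [mul_assoc, Matrix.nonsing_inv_mul _ hd,
    Matrix.nonsing_inv_mul_cancel_left C _ hd]⟩

/-- If the commutators with `D` lie in the span of a finite family, then the size of the family
bounds the rank of `twistedConj A B - 1` for `A`, `B` conjugate to `D`. -/
theorem finrank_range_twistedConj_sub_one_le {n : ℕ} {ι : Type*} [Fintype ι]
    {A B D : Matrix (Fin n) (Fin n) ℂ} (hA : MatConj A D) (hB : MatConj B D) (hAU : IsUnit A)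
    (S : ι → Matrix (Fin n) (Fin n) ℂ) (c : Matrix (Fin n) (Fin n) ℂ → ι → ℂ)
    (hS : ∀ X, D * X - X * D = ∑ i, c X i • S i) :
    Module.finrank ℂ (LinearMap.range (twistedConj A B - 1)) ≤ Fintype.card ι := by
  obtain ⟨g, hg, hgA⟩ := hA.exists_eq
  obtain ⟨h, hh, hhB⟩ := hB.exists_eq
  have hgd := (Matrix.isUnit_iff_isUnit_det g).1 hg
  have hhd := (Matrix.isUnit_iff_isUnit_det h).1 hh
  have hAd := (Matrix.isUnit_iff_isUnit_det A).1 hAU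
  refine (Submodule.finrank_mono ?_).trans
    (finrank_range_le_card (R := ℂ) fun i => h⁻¹ * S i * (g * A⁻¹))
  rintro _ ⟨X, rfl⟩
  have key : (twistedConj A B - 1) X =
      h⁻¹ * (D * (h * X * g⁻¹) - (h * X * g⁻¹) * D) * (g * A⁻¹) := by
    have h₁ : h⁻¹ * (D * (h * X * g⁻¹)) * (g * A⁻¹) = B * X * A⁻¹ := by
      simp only [hhB, mul_assoc, Matrix.nonsing_inv_mul_cancel_left g _ hgd]
    have h₂ : h⁻¹ * ((h * X * g⁻¹) * D) * (g * A⁻¹) = X := by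
      have : h⁻¹ * ((h * X * g⁻¹) * D) * (g * A⁻¹) = X * ((g⁻¹ * D * g) * A⁻¹) := by
        simp only [mul_assoc, Matrix.nonsing_inv_mul_cancel_left h _ hhd]
      rw [this, ← hgA, Matrix.mul_nonsing_inv A hAd, mul_one]
    rw [mul_sub, sub_mul, h₁, h₂, LinearMap.sub_apply, twistedConj_apply, Module.End.one_apply]
  rw [key, hS, Finset.mul_sum, Finset.sum_mul]
  refine Submodule.sum_mem _ fun i _ => ?_
  rw [mul_smul_comm, smul_mul_assoc]
  exact Submodule.smul_mem _ _ (Submodule.subset_span ⟨i, rfl⟩)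

theorem diagonal_commutator_eq_sum {n : ℕ} (d : Fin n → ℂ) (s : Finset (Fin n × Fin n))
    (hs : ∀ p ∉ s, d p.1 = d p.2) (X : Matrix (Fin n) (Fin n) ℂ) :
    diagonal d * X - X * diagonal d =
      ∑ p : s, ((d p.1.1 - d p.1.2) * X p.1.1 p.1.2) • Matrix.single p.1.1 p.1.2 (1 : ℂ) := by
  rw [Finset.sum_coe_sort s
      fun p => ((d p.1 - d p.2) * X p.1 p.2) • Matrix.single p.1 p.2 (1 : ℂ),
    Finset.sum_subset s.subset_univ fun p _ hp => by simp [hs p hp]]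
  ext i j
  rw [Fintype.sum_prod_type, Matrix.sum_apply]
  simp [Matrix.sum_apply, Matrix.single_apply, ite_and, mul_comm (X i j), sub_mul]

theorem finrank_range_twistedConj_sub_one_le_of_diagonal {n : ℕ}
    {A B : Matrix (Fin n) (Fin n) ℂ} {d : Fin n → ℂ} (hA : MatConj A (diagonal d))
    (hB : MatConj B (diagonal d)) (hAU : IsUnit A) (s : Finset (Fin n × Fin n))
    (hs : ∀ p ∉ s, d p.1 = d p.2) :
    Module.finrank ℂ (LinearMap.range (twistedConj A B - 1)) ≤ s.card := by
  simpa using finrank_range_twistedConj_sub_one_le hA hB hAU _ _ (diagonal_commutator_eq_sum d s hs)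

theorem finrank_range_twistedConj_sub_one_le_of_transvection
    {A B : Matrix (Fin 4) (Fin 4) ℂ}
    (hA : MatConj A !![1, 1, 0, 0; 0, 1, 0, 0; 0, 0, 1, 0; 0, 0, 0, 1])
    (hB : MatConj B !![1, 1, 0, 0; 0, 1, 0, 0; 0, 0, 1, 0; 0, 0, 0, 1]) (hAU : IsUnit A) :
    Module.finrank ℂ (LinearMap.range (twistedConj A B - 1)) ≤ 6 := by
  refine finrank_range_twistedConj_sub_one_le (ι := Fin 6) hA hB hAU
    ![single 0 0 1 - single 1 1 1, single 0 1 1, single 0 2 1, single 0 3 1, single 2 1 1,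
      single 3 1 1]
    (fun X => ![X 1 0, X 1 1 - X 0 0, X 1 2, X 1 3, -X 2 0, -X 3 0]) fun X => ?_
  ext i j
  fin_cases i <;> fin_cases j <;>
    simp [Matrix.sub_apply, Matrix.vecMul, dotProduct, Matrix.mul_apply, Fin.sum_univ_succ,
      Matrix.sum_apply] <;>
    ring

theorem exists_eq_trace_mul {n : ℕ} (f : Matrix (Fin n) (Fin n) ℂ →ₗ[ℂ] ℂ) :
    ∃ Y : Matrix (Fin n) (Fin n) ℂ, ∀ X, f X = (Y * X).trace := by
  refine ⟨Matrix.of fun i j => f (single j i 1), fun X => ?_⟩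
  conv_lhs => rw [Matrix.matrix_eq_sum_single X]
  simp only [map_sum, Matrix.trace, Matrix.diag_apply, Matrix.mul_apply, Matrix.of_apply]
  rw [Finset.sum_comm]
  refine Finset.sum_congr rfl fun i _ => Finset.sum_congr rfl fun j _ => ?_
  rw [mul_comm, ← smul_eq_mul, ← map_smul, Matrix.smul_single, smul_eq_mul, mul_one]

theorem mul_eq_mul_of_trace_twistedConj {n : ℕ} {A B Y : Matrix (Fin n) (Fin n) ℂ}
    (hA : IsUnit A) (h : ∀ X, (Y * twistedConj A B X).trace = (Y * X).trace) :
    Y * B = A * Y := by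
  have hd := (Matrix.isUnit_iff_isUnit_det A).1 hA
  have h' : A⁻¹ * (Y * B) = Y := by
    refine Matrix.ext_iff_trace_mul_right.2 fun X => ?_
    rw [← h X, twistedConj_apply, mul_assoc, Matrix.trace_mul_comm]
    simp only [mul_assoc]
  rw [← Matrix.mul_nonsing_inv_cancel_left A (Y * B) hd, h']

/-- Schur's lemma: a nonzero intertwiner out of an irreducible tuple is invertible. -/
theorem MatIrred.isUnit_of_mul_eq_mul {n : ℕ} {s : Set (Matrix (Fin n) (Fin n) ℂ)}
    (hs : MatIrred s) {X : Matrix (Fin n) (Fin n) ℂ} (hX : X ≠ 0)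
    (h : ∀ A ∈ s, ∃ B, X * A = B * X) : IsUnit X := by
  rcases hs (LinearMap.ker X.mulVecLin) fun A hA v hv => by
      obtain ⟨B, hB⟩ := h A hA
      rw [LinearMap.mem_ker, Matrix.mulVecLin_apply] at hv ⊢
      rw [Matrix.mulVec_mulVec, hB, ← Matrix.mulVec_mulVec, hv, Matrix.mulVec_zero] with h₀ | h₁
  · exact Matrix.mulVec_injective_iff_isUnit.1 (LinearMap.ker_eq_bot.1 h₀)
  · refine absurd ?_ hX
    have h₂ := LinearMap.ker_eq_top.1 h₁
    rw [← Matrix.toLin'_apply'] at h₂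
    simpa using h₂

theorem exists_intertwiner_of_finrank_lt {n : ℕ}
    {A₁ A₂ A₃ A₄ B₁ B₂ B₃ B₄ : Matrix (Fin n) (Fin n) ℂ}
    (hU₁ : IsUnit A₁) (hU₂ : IsUnit A₂) (hU₃ : IsUnit A₃) (hU₄ : IsUnit A₄)
    (hA : A₁ * A₂ * A₃ * A₄ = 1) (hB : B₁ * B₂ * B₃ * B₄ = 1)
    (hlt : Module.finrank ℂ (LinearMap.range (twistedConj A₁ B₁ - 1)) +
      Module.finrank ℂ (LinearMap.range (twistedConj A₂ B₂ - 1)) +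
      Module.finrank ℂ (LinearMap.range (twistedConj A₃ B₃ - 1)) +
      Module.finrank ℂ (LinearMap.range (twistedConj A₄ B₄ - 1)) < 2 * (n * n)) :
    (∃ X ≠ 0, X * A₁ = B₁ * X ∧ X * A₂ = B₂ * X ∧ X * A₃ = B₃ * X ∧ X * A₄ = B₄ * X) ∨
    (∃ Y ≠ 0, Y * B₁ = A₁ * Y ∧ Y * B₂ = A₂ * Y ∧ Y * B₃ = A₃ * Y ∧ Y * B₄ = A₄ * Y) := by
  by_contra! hcon
  obtain ⟨hX, hY⟩ := hcon
  refine hlt.not_ge ?_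
  have hdim : Module.finrank ℂ (Matrix (Fin n) (Fin n) ℂ) = n * n := by
    simp [Module.finrank_matrix]
  rw [← hdim]
  refine two_mul_finrank_le_of_mul_eq_one _ _ _ _ ?_ (fun X h₁ h₂ h₃ h₄ => ?_)
    (fun f h₁ h₂ h₃ h₄ => ?_)
  · ext1 X
    have hA' : A₄⁻¹ * A₃⁻¹ * A₂⁻¹ * A₁⁻¹ = 1 := by
      have := congrArg (·⁻¹) hA
      simpa [Matrix.mul_inv_rev, mul_assoc] using this
    calc _ = (B₁ * B₂ * B₃ * B₄) * X * (A₄⁻¹ * A₃⁻¹ * A₂⁻¹ * A₁⁻¹) := by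
          simp only [Module.End.mul_apply, twistedConj_apply, mul_assoc]
      _ = X := by rw [hA', hB, one_mul, mul_one]
  · by_contra hne
    exact hX X hne (twistedConj_eq_self hU₁ h₁) (twistedConj_eq_self hU₂ h₂)
      (twistedConj_eq_self hU₃ h₃) (twistedConj_eq_self hU₄ h₄)
  · obtain ⟨Y, hf⟩ := exists_eq_trace_mul f
    simp only [hf] at h₁ h₂ h₃ h₄
    by_contra hne
    refine hY Y (fun h₀ => hne ?_) (mul_eq_mul_of_trace_twistedConj hU₁ h₁)
      (mul_eq_mul_of_trace_twistedConj hU₂ h₂) (mul_eq_mul_of_trace_twistedConj hU₃ h₃)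
      (mul_eq_mul_of_trace_twistedConj hU₄ h₄)
    ext1 X
    simp [hf, h₀]

theorem stmt_6 (a b : ℝ) (ha : a ∈ Set.Ioo (1 / 2 : ℝ) 1) (hb : b ∈ Set.Ioo (1 / 2 : ℝ) 1)
    (hab : a ≠ b) (α β : ℂ)
    (hα : α = Complex.exp (-2 * Real.pi * Complex.I * a))
    (hβ : β = Complex.exp (-2 * Real.pi * Complex.I * b))
    (A0 A1 A4 Ainf B0 B1 B4 Binf : Matrix (Fin 4) (Fin 4) ℂ)
    (hAU : IsUnit A0 ∧ IsUnit A1 ∧ IsUnit A4 ∧ IsUnit Ainf)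
    (hBU : IsUnit B0 ∧ IsUnit B1 ∧ IsUnit B4 ∧ IsUnit Binf)
    (hAirr : MatIrred {A0, A1, A4, Ainf})
    (hBirr : MatIrred {B0, B1, B4, Binf})
    (hAprod : A0 * A1 * A4 * Ainf = 1)
    (hBprod : B0 * B1 * B4 * Binf = 1)
    (hA0 : MatConj A0 !![1, 1, 0, 0; 0, 1, 0, 0; 0, 0, 1, 0; 0, 0, 0, 1])
    (hA4 : MatConj A4 !![1, 1, 0, 0; 0, 1, 0, 0; 0, 0, 1, 0; 0, 0, 0, 1])
    (hA1 : MatConj A1 !![α, 0, 0, 0; 0, α⁻¹, 0, 0; 0, 0, 1, 0; 0, 0, 0, 1])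
    (hAinf : MatConj Ainf !![β, 0, 0, 0; 0, β, 0, 0; 0, 0, β⁻¹, 0; 0, 0, 0, β⁻¹])
    (hB0 : MatConj B0 !![1, 1, 0, 0; 0, 1, 0, 0; 0, 0, 1, 0; 0, 0, 0, 1])
    (hB4 : MatConj B4 !![1, 1, 0, 0; 0, 1, 0, 0; 0, 0, 1, 0; 0, 0, 0, 1])
    (hB1 : MatConj B1 !![α, 0, 0, 0; 0, α⁻¹, 0, 0; 0, 0, 1, 0; 0, 0, 0, 1])
    (hBinf : MatConj Binf !![β, 0, 0, 0; 0, β, 0, 0; 0, 0, β⁻¹, 0; 0, 0, 0, β⁻¹]) :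
    ∃ C : Matrix (Fin 4) (Fin 4) ℂ, IsUnit C ∧
      C * A0 * C⁻¹ = B0 ∧ C * A1 * C⁻¹ = B1 ∧ C * A4 * C⁻¹ = B4 ∧ C * Ainf * C⁻¹ = Binf := by
  have hdiag (w x y z : ℂ) :
      !![w, 0, 0, 0; 0, x, 0, 0; 0, 0, y, 0; 0, 0, 0, z] = diagonal ![w, x, y, z] := by
    ext i j
    fin_cases i <;> fin_cases j <;> simp
  rw [hdiag] at hA1 hAinf hB1 hBinf
  obtain ⟨hU0, hU1, hU4, hUinf⟩ := hAU
  have h0 := finrank_range_twistedConj_sub_one_le_of_transvection hA0 hB0 hU0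
  have h4 := finrank_range_twistedConj_sub_one_le_of_transvection hA4 hB4 hU4
  have h1 : Module.finrank ℂ (LinearMap.range (twistedConj A1 B1 - 1)) ≤ 10 :=
    finrank_range_twistedConj_sub_one_le_of_diagonal hA1 hB1 hU1
      {p | p.1 ≠ p.2 ∧ (p.1 < 2 ∨ p.2 < 2)} (by
        rintro ⟨i, j⟩ hp
        fin_cases i <;> fin_cases j <;> simp at hp ⊢)
  have hinf : Module.finrank ℂ (LinearMap.range (twistedConj Ainf Binf - 1)) ≤ 8 :=
    finrank_range_twistedConj_sub_one_le_of_diagonal hAinf hBinf hUinf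
      {p | ¬(p.1 < 2 ↔ p.2 < 2)} (by
        rintro ⟨i, j⟩ hp
        fin_cases i <;> fin_cases j <;> simp at hp ⊢)
  rcases exists_intertwiner_of_finrank_lt hU0 hU1 hU4 hUinf hAprod hBprod (by omega) with
    ⟨X, hX, e0, e1, e4, einf⟩ | ⟨Y, hY, e0, e1, e4, einf⟩
  · have hXU : IsUnit X := hAirr.isUnit_of_mul_eq_mul hX (by
      rintro A (rfl | rfl | rfl | rfl)
      exacts [⟨_, e0⟩, ⟨_, e1⟩, ⟨_, e4⟩, ⟨_, einf⟩])
    have hd := (Matrix.isUnit_iff_isUnit_det X).1 hXU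
    refine ⟨X, hXU, ?_, ?_, ?_, ?_⟩
    · rw [e0, Matrix.mul_nonsing_inv_cancel_right X _ hd]
    · rw [e1, Matrix.mul_nonsing_inv_cancel_right X _ hd]
    · rw [e4, Matrix.mul_nonsing_inv_cancel_right X _ hd]
    · rw [einf, Matrix.mul_nonsing_inv_cancel_right X _ hd]
  · have hYU : IsUnit Y := hBirr.isUnit_of_mul_eq_mul hY (by
      rintro B (rfl | rfl | rfl | rfl)
      exacts [⟨_, e0⟩, ⟨_, e1⟩, ⟨_, e4⟩, ⟨_, einf⟩])
    have hd := (Matrix.isUnit_iff_isUnit_det Y).1 hYU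
    refine ⟨Y⁻¹, Matrix.isUnit_nonsing_inv_iff.2 hYU, ?_, ?_, ?_, ?_⟩ <;>
      rw [Matrix.nonsing_inv_nonsing_inv Y hd, mul_assoc]
    · rw [← e0, Matrix.nonsing_inv_mul_cancel_left Y _ hd]
    · rw [← e1, Matrix.nonsing_inv_mul_cancel_left Y _ hd]
    · rw [← e4, Matrix.nonsing_inv_mul_cancel_left Y _ hd]
    · rw [← einf, Matrix.nonsing_inv_mul_cancel_left Y _ hd]
end

section
/- Let α ∈ ℂ with α ∉ {0, 1, −1}. Then there exist matrices A₀, A₁, A₄ ∈ SL₂(ℂ) such that: (i) A₀·A₁·A₄ = I; (ii) A₀ and A₄ are each conjugate in GL₂(ℂ) to J₂(1); (iii) A₁ is conjugate to the diagonal matrix diag(α, α⁻¹); (iv) the tuple (A₀, A₁, A₄) is irreducible. Moreover, the tuple is linearly rigid: for any irreducible tuple (B₀, B₁, B₄) in GL₂(ℂ) with B₀·B₁·B₄ = I, B₀ and B₄ conjugate to J₂(1), and B₁ conjugate to diag(α, α⁻¹), there exists C ∈ GL₂(ℂ) with C·A_s·C⁻¹ = B_s for all s ∈ {0, 1, 4}.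 -/
/-!
Statement 7: existence and linear rigidity of the monodromy tuple of the
rank-2 rigid local system 𝒫₂.
-/

open Matrix

theorem matConj_of_mul_eq {n : ℕ} {A B C : Matrix (Fin n) (Fin n) ℂ} (hC : IsUnit C)
    (h : C * A = B * C) : C * A * C⁻¹ = B := by
  rw [h, mul_nonsing_inv_cancel_right _ _ ((isUnit_iff_isUnit_det C).1 hC)]

theorem MatConj.trace_eq {n : ℕ} {A B : Matrix (Fin n) (Fin n) ℂ} (h : MatConj A B) :
    A.trace = B.trace := by
  obtain ⟨C, hC, rfl⟩ := h
  rw [trace_mul_comm, nonsing_inv_mul_cancel_left _ _ ((isUnit_iff_isUnit_det C).1 hC)]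

theorem MatConj.det_eq {n : ℕ} {A B : Matrix (Fin n) (Fin n) ℂ} (h : MatConj A B) :
    A.det = B.det := by
  obtain ⟨C, hC, rfl⟩ := h
  have hd := (isUnit_iff_isUnit_det C).1 hC
  rw [det_mul, det_mul, mul_right_comm, ← det_mul, mul_nonsing_inv _ hd, det_one, one_mul]

/-- A pair of matrices of trace `0` and determinant `0` whose product has nonzero trace `t` is
simultaneously conjugate to the pair of elementary matrices `E₁₂`, `t E₂₁`. -/
theorem exists_isUnit_intertwining {N M : Matrix (Fin 2) (Fin 2) ℂ} {t : ℂ} (ht : t ≠ 0)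
    (hN : N.trace = 0) (hN' : N.det = 0) (hM : M.trace = 0) (hM' : M.det = 0)
    (hNM : (N * M).trace = t) :
    ∃ C : Matrix (Fin 2) (Fin 2) ℂ, IsUnit C ∧
      C * !![0, 1; 0, 0] = N * C ∧ C * !![0, 0; t, 0] = M * C := by
  have key : ∀ x y : ℂ, (x ≠ 0 ∨ y ≠ 0) → M 0 0 * x + M 0 1 * y = 0 →
      M 1 0 * x + M 1 1 * y = 0 → ∃ C : Matrix (Fin 2) (Fin 2) ℂ, IsUnit C ∧
      C * !![0, 1; 0, 0] = N * C ∧ C * !![0, 0; t, 0] = M * C := by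
    intro x y hxy h0 h1
    rw [trace_fin_two] at hN hM hNM
    rw [det_fin_two] at hN' hM'
    simp only [mul_apply, Fin.sum_univ_two] at hNM
    have e0 : M 0 0 * (N 0 0 * x + N 0 1 * y) + M 0 1 * (N 1 0 * x + N 1 1 * y) = t * x := by
      grind
    have e1 : M 1 0 * (N 0 0 * x + N 0 1 * y) + M 1 1 * (N 1 0 * x + N 1 1 * y) = t * y := by
      grind
    refine ⟨!![N 0 0 * x + N 0 1 * y, x; N 1 0 * x + N 1 1 * y, y], ?_, ?_, ?_⟩
    · rw [isUnit_iff_isUnit_det, isUnit_iff_ne_zero, det_fin_two_of]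
      intro hd
      have hx : t * x * x = 0 := by
        linear_combination -x * e0 + M 0 1 * (-hd) + (N 0 0 * x + N 0 1 * y) * h0
      have hy : t * y * y = 0 := by
        linear_combination -y * e1 + M 1 0 * hd + (N 1 0 * x + N 1 1 * y) * h1
      grind
    · ext i j
      fin_cases i <;> fin_cases j <;> simp [mul_apply, Fin.sum_univ_two] <;> grind
    · ext i j
      fin_cases i <;> fin_cases j <;> simp [mul_apply, Fin.sum_univ_two] <;> grind
  rw [trace_fin_two] at hM
  rw [det_fin_two] at hM'
  by_cases h : M 0 0 ≠ 0 ∨ M 1 0 ≠ 0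
  · exact key (M 0 0) (M 1 0) h (by grind) (by grind)
  · exact key 1 0 (by simp) (by grind) (by grind)

theorem matIrred_of_elementary_mem {s : Set (Matrix (Fin 2) (Fin 2) ℂ)} {t : ℂ} (ht : t ≠ 0)
    (h0 : !![1, 1; 0, 1] ∈ s) (h1 : !![1, 0; t, 1] ∈ s) : MatIrred s := by
  intro W hW
  have hN : ∀ v ∈ W, ![v 1, 0] ∈ W := fun v hv => by
    convert W.sub_mem (hW _ h0 v hv) hv using 1
    ext i
    fin_cases i <;> simp [vecHead, vecTail]
  have hM : ∀ v ∈ W, ![0, v 0] ∈ W := fun v hv => by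
    convert W.smul_mem t⁻¹ (W.sub_mem (hW _ h1 v hv) hv) using 1
    ext i
    fin_cases i <;> simp [vecHead, vecTail, ht]
  refine or_iff_not_imp_left.2 fun hb => ?_
  obtain ⟨v, hv, hv0⟩ := W.ne_bot_iff.1 hb
  have span : ∀ c : ℂ, c ≠ 0 → ![c, 0] ∈ W → ![0, c] ∈ W → W = ⊤ := by
    intro c hc h h'
    refine W.eq_top_iff'.2 fun w => ?_
    convert W.add_mem (W.smul_mem (w 0 / c) h) (W.smul_mem (w 1 / c) h') using 1
    ext i
    fin_cases i <;> simp [hc]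
  by_cases h : v 0 = 0
  · have h' : v 1 ≠ 0 := fun h' => hv0 (by ext i; fin_cases i <;> simp [h, h'])
    have := hN v hv
    exact span _ h' this (by simpa using hM _ this)
  · have := hM v hv
    exact span _ h (by simpa using hN _ this) this

theorem stmt_7 (α : ℂ) (hα : α ∉ ({0, 1, -1} : Set ℂ)) :
    ∃ A0 A1 A4 : Matrix (Fin 2) (Fin 2) ℂ,
      A0.det = 1 ∧ A1.det = 1 ∧ A4.det = 1 ∧
      A0 * A1 * A4 = 1 ∧
      MatConj A0 !![1, 1; 0, 1] ∧
      MatConj A4 !![1, 1; 0, 1] ∧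
      MatConj A1 !![α, 0; 0, α⁻¹] ∧
      MatIrred {A0, A1, A4} ∧
      ∀ B0 B1 B4 : Matrix (Fin 2) (Fin 2) ℂ,
        IsUnit B0 → IsUnit B1 → IsUnit B4 →
        B0 * B1 * B4 = 1 →
        MatConj B0 !![1, 1; 0, 1] →
        MatConj B4 !![1, 1; 0, 1] →
        MatConj B1 !![α, 0; 0, α⁻¹] →
        MatIrred {B0, B1, B4} →
        ∃ C : Matrix (Fin 2) (Fin 2) ℂ, IsUnit C ∧
          C * A0 * C⁻¹ = B0 ∧ C * A1 * C⁻¹ = B1 ∧ C * A4 * C⁻¹ = B4 := by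
  obtain ⟨hα0, hα1, hα2⟩ : α ≠ 0 ∧ α ≠ 1 ∧ α ≠ -1 := by simpa using hα
  obtain ⟨t, ht⟩ : ∃ t, t = α + α⁻¹ - 2 := ⟨_, rfl⟩
  have ht' : t * α = (α - 1) ^ 2 := by rw [ht]; field_simp; ring
  have ht0 : t ≠ 0 := by
    rintro rfl
    exact pow_ne_zero 2 (sub_ne_zero.2 hα1) (by rw [← ht', zero_mul])
  have hA : (!![1, 1; 0, 1] : Matrix (Fin 2) (Fin 2) ℂ) * !![1 + t, -1; -t, 1] * !![1, 0; t, 1]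
      = 1 := by
    ext i j
    fin_cases i <;> fin_cases j <;> simp [mul_apply, Fin.sum_univ_two]
  refine ⟨!![1, 1; 0, 1], !![1 + t, -1; -t, 1], !![1, 0; t, 1], by simp, by simp [det_fin_two],
    by simp, hA, ⟨1, isUnit_one, by simp⟩, ⟨!![0, 1; t, 0], ?_, matConj_of_mul_eq ?_ ?_⟩,
    ⟨!![1 - α, 1; 1 - α⁻¹, 1], ?_, matConj_of_mul_eq ?_ ?_⟩,
    matIrred_of_elementary_mem ht0 (by simp) (by simp), ?_⟩
  iterate 2 simpa [isUnit_iff_isUnit_det] using ht0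
  · ext i j
    fin_cases i <;> fin_cases j <;> simp [mul_apply, Fin.sum_univ_two]
  iterate 2
    rw [isUnit_iff_isUnit_det, isUnit_iff_ne_zero, det_fin_two_of]
    intro h
    have h' : (α - 1) * (α + 1) = 0 := by
      field_simp at h
      linear_combination -h
    grind
  · ext i j
    fin_cases i <;> fin_cases j <;> simp [mul_apply, Fin.sum_univ_two, ht] <;> grind
  intro B0 B1 B4 hU0 _ _ hB h0 h4 h1 _
  have tr0 := h0.trace_eq
  have tr4 := h4.trace_eq
  have tr1 := h1.trace_eq
  have d0 := h0.det_eq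
  have d4 := h4.det_eq
  simp only [trace_fin_two_of, det_fin_two_of] at tr0 tr4 tr1 d0 d4
  rw [trace_fin_two] at tr0 tr4
  rw [det_fin_two] at d0 d4
  have hB1 : B1 = B0.adjugate * B4.adjugate := by
    calc B1 = B0.adjugate * (B0 * B1 * B4) * B4.adjugate := by
          simp only [← Matrix.mul_assoc, adjugate_mul]
          rw [Matrix.mul_assoc _ B4, mul_adjugate]
          simp [det_fin_two, d0, d4]
      _ = _ := by rw [hB, Matrix.mul_one]
  obtain ⟨C, hC, hCN, hCM⟩ := exists_isUnit_intertwining (N := B0 - 1) (M := B4 - 1) ht0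
    (by simp [trace_fin_two]; grind) (by simp [det_fin_two]; grind)
    (by simp [trace_fin_two]; grind) (by simp [det_fin_two]; grind)
    (by
      rw [hB1] at tr1
      simp [trace_fin_two, mul_apply, Fin.sum_univ_two, adjugate_fin_two] at tr1 ⊢
      grind)
  have hC0 : C * !![1, 1; 0, 1] = B0 * C := by
    have : (!![1, 1; 0, 1] : Matrix (Fin 2) (Fin 2) ℂ) = 1 + !![0, 1; 0, 0] := by
      ext i j
      fin_cases i <;> fin_cases j <;> simp
    rw [this, Matrix.mul_add, hCN]
    noncomm_ring
  have hC4 : C * !![1, 0; t, 1] = B4 * C := by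
    have : (!![1, 0; t, 1] : Matrix (Fin 2) (Fin 2) ℂ) = 1 + !![0, 0; t, 0] := by
      ext i j
      fin_cases i <;> fin_cases j <;> simp
    rw [this, Matrix.mul_add, hCM]
    noncomm_ring
  refine ⟨C, hC, matConj_of_mul_eq hC hC0, matConj_of_mul_eq hC ?_, matConj_of_mul_eq hC hC4⟩
  have hUA : IsUnit (!![1, 0; t, 1] : Matrix (Fin 2) (Fin 2) ℂ) := by
    simp [isUnit_iff_isUnit_det]
  refine hU0.mul_left_cancel (hUA.mul_right_cancel ?_)
  calc B0 * (C * !![1 + t, -1; -t, 1]) * !![1, 0; t, 1]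
      = C * (!![1, 1; 0, 1] * !![1 + t, -1; -t, 1] * !![1, 0; t, 1]) := by
        simp only [← Matrix.mul_assoc, hC0]
    _ = B0 * B1 * B4 * C := by rw [hA, hB, Matrix.mul_one, Matrix.one_mul]
    _ = B0 * (B1 * C) * !![1, 0; t, 1] := by simp only [Matrix.mul_assoc, hC4]
end

section
/- Let A₁, …, A_r ∈ GL_n(ℂ) be an irreducible tuple with A₁·A₂⋯A_r = I. Assume the tuple is linearly rigid: every irreducible tuple (B₁, …, B_r) in GL_n(ℂ) with B₁⋯B_r = I and with each Bᵢ conjugate to Aᵢ in GL_n(ℂ) is simultaneously conjugate to (A₁, …, A_r). Assume furthermore that each Aᵢ is conjugate in GL_n(ℂ) to (Aᵢᵀ)⁻¹ (equivalently, the eigenvalues of each local monodromy, with multiplicities and Jordan structure, are invariant under taking inverses). Then the tuple is self-dual: there exists an invertible matrix S ∈ GL_n(ℂ) with AᵢᵀSAᵢ = S for all i, i.e., all Aᵢ preserve a common nondegenerate bilinear form on ℂⁿ. -/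
/-!
Statement 11: a linearly rigid irreducible tuple whose local monodromies have
inverse-invariant Jordan structure is self-dual: it preserves a common
nondegenerate bilinear form.
-/

open Matrix

/-- The transpose inverse as a monoid homomorphism on square matrices. -/
noncomputable def transposeInvHom (m R : Type*) [Fintype m] [DecidableEq m] [CommRing R] :
    Matrix m m R →* Matrix m m R where
  toFun A := Aᵀ⁻¹
  map_one' := by simp
  map_mul' A B := by rw [transpose_mul, Matrix.mul_inv_rev]

/-- The orthogonal complement of a subspace with respect to the dot product. -/
def dotOrthogonal {m K : Type*} [Fintype m] [Field K] (W : Submodule K (m → K)) :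
    Submodule K (m → K) where
  carrier := {u | ∀ w ∈ W, w ⬝ᵥ u = 0}
  zero_mem' _ _ := dotProduct_zero _
  add_mem' hu hv w hw := by rw [dotProduct_add, hu w hw, hv w hw, add_zero]
  smul_mem' c u hu w hw := by rw [dotProduct_smul, hu w hw, smul_zero]

theorem eq_bot_of_dotOrthogonal_eq_top {m K : Type*} [Fintype m] [Field K]
    {W : Submodule K (m → K)} (h : dotOrthogonal W = ⊤) : W = ⊥ := by
  rw [Submodule.eq_bot_iff]
  intro w hw
  refine dotProduct_eq_zero w fun u => ?_
  have hu : u ∈ dotOrthogonal W := h ▸ Submodule.mem_top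
  exact hu w hw

theorem eq_top_of_dotOrthogonal_eq_bot {m K : Type*} [Fintype m] [DecidableEq m] [Field K]
    {W : Submodule K (m → K)} (h : dotOrthogonal W = ⊥) : W = ⊤ := by
  by_contra hW
  obtain ⟨f, hf, hWf⟩ := W.exists_le_ker_of_lt_top (lt_top_iff_ne_top.2 hW)
  let u : m → K := fun i => f fun j => if i = j then 1 else 0
  have hdot (v : m → K) : v ⬝ᵥ u = f v := (f.pi_apply_eq_sum_univ v).symm
  have hu : u ∈ dotOrthogonal W := fun w hw => (hdot w).trans (hWf hw)
  rw [h, Submodule.mem_bot] at hu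
  refine hf (LinearMap.ext fun v => ?_)
  rw [← hdot, hu, dotProduct_zero, LinearMap.zero_apply]

/-- A subspace preserved by the inverse of an invertible matrix is preserved by the matrix. -/
theorem mulVec_mem_of_inv_mulVec_mem {m K : Type*} [Fintype m] [DecidableEq m] [Field K]
    {M : Matrix m m K} (hM : IsUnit M) {W : Submodule K (m → K)}
    (hW : ∀ v ∈ W, M⁻¹ *ᵥ v ∈ W) {v : m → K} (hv : v ∈ W) : M *ᵥ v ∈ W := by
  have hdet := (isUnit_iff_isUnit_det M).1 hM
  have hinj : Function.Injective (M⁻¹.mulVecLin.restrict hW) := by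
    refine LinearMap.injective_restrict_iff hW |>.2 ?_
    rw [LinearMap.ker_eq_bot.2 (mulVec_injective_of_isUnit (isUnit_nonsing_inv_iff.2 hM))]
    exact disjoint_bot_right
  obtain ⟨⟨w, hw⟩, hwv⟩ := LinearMap.surjective_of_injective hinj ⟨v, hv⟩
  have hwv' : M⁻¹ *ᵥ w = v := congrArg Subtype.val hwv
  rwa [← hwv', mulVec_mulVec, mul_nonsing_inv M hdet, one_mulVec]

theorem MatIrred.transpose_inv {n : ℕ} {ι : Type*} {A : ι → Matrix (Fin n) (Fin n) ℂ}
    (hU : ∀ i, IsUnit (A i)) (hirr : MatIrred (Set.range A)) :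
    MatIrred (Set.range fun i => (A i)ᵀ⁻¹) := by
  intro W hW
  have hinv : ∀ M ∈ Set.range A, ∀ u ∈ dotOrthogonal W, M *ᵥ u ∈ dotOrthogonal W := by
    rintro _ ⟨i, rfl⟩ u hu w hw
    rw [dotProduct_mulVec, ← mulVec_transpose]
    exact hu _ (mulVec_mem_of_inv_mulVec_mem ((isUnit_transpose (A i)).2 (hU i))
      (hW _ ⟨i, rfl⟩) hw)
  exact (hirr _ hinv).symm.imp eq_bot_of_dotOrthogonal_eq_top eq_top_of_dotOrthogonal_eq_bot

theorem stmt_11 (n r : ℕ) (A : Fin r → Matrix (Fin n) (Fin n) ℂ)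
    (hU : ∀ i, IsUnit (A i))
    (hirr : MatIrred (Set.range A))
    (hprod : (List.ofFn A).prod = 1)
    (hrigid : ∀ B : Fin r → Matrix (Fin n) (Fin n) ℂ,
      (∀ i, IsUnit (B i)) → MatIrred (Set.range B) → (List.ofFn B).prod = 1 →
      (∀ i, MatConj (A i) (B i)) →
      ∃ C : Matrix (Fin n) (Fin n) ℂ, IsUnit C ∧ ∀ i, C * A i * C⁻¹ = B i)
    (hdual : ∀ i, MatConj (A i) ((A i)ᵀ)⁻¹) :
    ∃ S : Matrix (Fin n) (Fin n) ℂ, IsUnit S ∧ ∀ i, (A i)ᵀ * S * A i = S := by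
  have hT (i : Fin r) : IsUnit (A i)ᵀ := (isUnit_transpose (A i)).2 (hU i)
  have hprod' : (List.ofFn fun i => (A i)ᵀ⁻¹).prod = 1 := by
    have h := congrArg (transposeInvHom (Fin n) ℂ) hprod
    rwa [map_list_prod, map_one, List.map_ofFn] at h
  obtain ⟨C, hC, hCA⟩ := hrigid (fun i => (A i)ᵀ⁻¹) (fun i => isUnit_nonsing_inv_iff.2 (hT i))
    (hirr.transpose_inv hU) hprod' hdual
  refine ⟨C, hC, fun i => ?_⟩
  have hCdet := (isUnit_iff_isUnit_det C).1 hC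
  have hTdet := (isUnit_iff_isUnit_det _).1 (hT i)
  have h : C * A i = (A i)ᵀ⁻¹ * C := by
    rw [← hCA i, nonsing_inv_mul_cancel_right _ _ hCdet]
  rw [Matrix.mul_assoc, h, mul_nonsing_inv_cancel_left _ _ hTdet]
end

section
/- Let G ⊆ GL_n(ℂ) be a set of invertible matrices acting irreducibly on ℂⁿ (the only common invariant subspaces are 0 and ℂⁿ), and suppose all elements of G preserve a common nondegenerate bilinear form given by an invertible matrix S (AᵀSA = S for all A ∈ G). If G contains a transvection, i.e., an element g ≠ I with rank(g − I) = 1 and (g − I)² = 0, then the form S is alternating: Sᵀ = −S (and hence n is even and G is contained in a symplectic group). -/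
/-!
Statement 12: an irreducible set of matrices preserving a nondegenerate
bilinear form and containing a transvection preserves an alternating form:
Sᵀ = −S.
-/

open Matrix

/-- A matrix of rank one is an outer product of two vectors. -/
theorem Matrix.exists_eq_vecMulVec_of_rank_eq_one {m n K : Type*} [Fintype m] [Fintype n]
    [DecidableEq n] [Field K] {N : Matrix m n K} (hN : N.rank = 1) :
    ∃ a b, N = vecMulVec a b := by
  obtain ⟨a, -, ha⟩ := finrank_eq_one_iff'.mp hN
  choose b hb using fun j ↦ ha ⟨N *ᵥ Pi.single j 1, LinearMap.mem_range_self N.mulVecLin _⟩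
  refine ⟨a, b, ?_⟩
  ext i j
  have h := congrFun (congrArg Subtype.val (hb j)) i
  simp only [SetLike.val_smul, Pi.smul_apply, smul_eq_mul, mulVec_single_one, col_apply] at h
  rw [vecMulVec_apply, ← h, mul_comm]

/-- A skew-symmetric outer product vanishes away from characteristic two. -/
theorem Matrix.vecMulVec_eq_zero_of_transpose_eq_neg {n K : Type*} [Field K] [NeZero (2 : K)]
    {a b : n → K} (h : (vecMulVec a b)ᵀ = -vecMulVec a b) : vecMulVec a b = 0 := by
  have hab (i j) : a j * b i = -(a i * b j) := congrFun (congrFun h i) j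
  have hdiag (i) : a i * b i = 0 := by
    have h2 : (2 : K) * (a i * b i) = 0 := by linear_combination hab i i
    exact (mul_eq_zero.mp h2).resolve_left two_ne_zero
  ext i j
  have hsq : (a i * b j) ^ 2 = 0 := by
    linear_combination a i * b j * hab i j - a j * b j * hdiag i
  simpa [vecMulVec_apply] using hsq

/-- The kernel of a bilinear form preserved by an irreducible set of invertible matrices is
trivial unless the form is zero. -/
theorem MatIrred.eq_zero_or_ker_eq_bot {n : ℕ} {G : Set (Matrix (Fin n) (Fin n) ℂ)}
    (hirr : MatIrred G) (hU : ∀ A ∈ G, IsUnit A) {T : Matrix (Fin n) (Fin n) ℂ}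
    (hT : ∀ A ∈ G, Aᵀ * T * A = T) : T = 0 ∨ LinearMap.ker T.mulVecLin = ⊥ := by
  refine (hirr (LinearMap.ker T.mulVecLin) fun A hA v hv ↦ ?_).symm.imp_left fun h ↦ ?_
  · simp only [LinearMap.mem_ker, mulVecLin_apply] at hv ⊢
    have hinj : Function.Injective Aᵀ.mulVec :=
      mulVec_injective_iff_isUnit.mpr ((isUnit_transpose A).mpr (hU A hA))
    apply hinj
    rw [mulVec_mulVec, mulVec_mulVec, hT A hA, hv, mulVec_zero]
  · exact toLin'.map_eq_zero_iff.mp (LinearMap.ker_eq_top.mp h)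

/-- If a square-zero perturbation `g` of the identity preserves a symmetric form `T`, then
`T * (g - 1)` is skew-symmetric. -/
theorem Matrix.transpose_mul_sub_one_eq_neg {n R : Type*} [Fintype n] [DecidableEq n]
    [CommRing R] {T g : Matrix n n R} (hsymm : Tᵀ = T) (hT : gᵀ * T * g = T)
    (hg : (g - 1) ^ 2 = 0) : (T * (g - 1))ᵀ = -(T * (g - 1)) := by
  obtain ⟨N, rfl⟩ : ∃ N, g = 1 + N := ⟨g - 1, by abel⟩
  rw [add_sub_cancel_left] at hg ⊢
  rw [transpose_add, transpose_one] at hT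
  have hexp : Nᵀ * T + T * N + Nᵀ * T * N = 0 := by
    rw [← sub_eq_zero.mpr hT]
    noncomm_ring
  have hNTN : Nᵀ * T * N = 0 := by
    have h := congrArg (· * N) hexp
    simpa [Matrix.add_mul, Matrix.mul_assoc, ← pow_two, hg] using h
  rw [hNTN, add_zero] at hexp
  rw [transpose_mul, hsymm]
  exact eq_neg_of_add_eq_zero_left hexp

theorem stmt_12 (n : ℕ) (G : Set (Matrix (Fin n) (Fin n) ℂ))
    (hU : ∀ A ∈ G, IsUnit A)
    (hirr : MatIrred G)
    (S : Matrix (Fin n) (Fin n) ℂ) (hS : IsUnit S)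
    (hpres : ∀ A ∈ G, Aᵀ * S * A = S)
    (htrans : ∃ g ∈ G, g ≠ 1 ∧ (g - 1).rank = 1 ∧ (g - 1) ^ 2 = 0) :
    Sᵀ = -S := by
  obtain ⟨g, hgG, hg1, hrank, hsq⟩ := htrans
  have hT : ∀ A ∈ G, Aᵀ * (Sᵀ + S) * A = Sᵀ + S := fun A hA ↦ by
    have h := congrArg transpose (hpres A hA)
    simp only [transpose_mul, transpose_transpose, ← Matrix.mul_assoc] at h
    rw [Matrix.mul_add, Matrix.add_mul, h, hpres A hA]
  rcases hirr.eq_zero_or_ker_eq_bot hU hT with h0 | hker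
  · exact eq_neg_of_add_eq_zero_left h0
  · have hsymm : (Sᵀ + S)ᵀ = Sᵀ + S := by
      rw [transpose_add, transpose_transpose, add_comm]
    have hskew := transpose_mul_sub_one_eq_neg hsymm (hT g hgG) hsq
    obtain ⟨a, b, hab⟩ := exists_eq_vecMulVec_of_rank_eq_one hrank
    rw [hab, mul_vecMulVec] at hskew
    have hzero : (Sᵀ + S) * (g - 1) = 0 := by
      rw [hab, mul_vecMulVec]
      exact vecMulVec_eq_zero_of_transpose_eq_neg hskew
    have hunit : IsUnit (Sᵀ + S) :=
      mulVec_injective_iff_isUnit.mp (LinearMap.ker_eq_bot.mp hker)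
    exact absurd (sub_eq_zero.mp (hunit.mul_right_eq_zero.mp hzero)) hg1
end
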